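/- Let X be a Banach space with direct sum decomposition X = X₁ ⊕ X₂ where dim X₂ < ∞. Let J ∈ C¹(X, ℝ) with J(0) = 0 satisfy the Palais–Smale condition, be bounded from below with inf_X J < 0, and suppose there is ρ > 0 such that J(u) ≥ 0 for all u ∈ X₁ with ‖u‖ ≤ ρ and J(u) ≤ 0 for all u ∈ X₂ with ‖u‖ ≤ ρ. Then J has at least two nontrivial critical points. -/

import Mathlib

open Filter Topology


theorem bn_zeroExt_lipschitz {E : Type*} [NormedAddCommGroup E] [NormedSpace ℝ E]
    (g : E → E) (R : ℝ) (C : NNReal)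
    (hg : LipschitzOnWith C g (Metric.closedBall 0 R)) (hz : ∀ x, ‖x‖ = R → g x = 0) (x y : E) :
    ‖(if ‖x‖ ≤ R then g x else 0) - (if ‖y‖ ≤ R then g y else 0)‖ ≤ C * ‖x - y‖ := by
  have key : ∀ x y : E, ‖x‖ ≤ R → R < ‖y‖ → ‖g x‖ ≤ C * ‖x - y‖ := by
    intro x y hx hy
    have hc : ContinuousOn (fun s : ℝ => ‖x + s • (y - x)‖) (Set.Icc 0 1) := by fun_prop
    have := intermediate_value_Icc (zero_le_one' ℝ) hc
    obtain ⟨s, hs, hsR⟩ := this (show R ∈ _ by simp [hx, hy.le])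
    simp only at hsR
    have h1 := hg.norm_sub_le (x := x) (y := x + s • (y - x)) (by simpa using hx)
      (by simp [hsR])
    rw [hz _ hsR, sub_zero] at h1
    refine h1.trans ?_
    have : x - (x + s • (y - x)) = s • (x - y) := by
      rw [smul_sub, smul_sub]; abel
    rw [this, norm_smul, Real.norm_eq_abs, abs_of_nonneg hs.1]
    have := mul_le_of_le_one_left (norm_nonneg (x - y)) hs.2
    gcongr
  split_ifs with h1 h2 h2
  · exact hg.norm_sub_le (by simpa using h1) (by simpa using h2)
  · simpa using key x y h1 (not_le.mp h2)
  · rw [zero_sub, norm_neg, norm_sub_rev]; exact key y x h2 (not_le.mp h1)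
  · simp; positivity

theorem bn_image_ball {E : Type*} [NormedAddCommGroup E] [NormedSpace ℝ E] [CompleteSpace E]
    (f : E → E) (R : ℝ) (c : NNReal) (hc : c < 1)
    (hf : ∀ x y, ‖f x - f y - (x - y)‖ ≤ c * ‖x - y‖) (hid : ∀ x, R ≤ ‖x‖ → f x = x) :
    Function.Injective f ∧ f '' Metric.ball 0 R = Metric.ball 0 R := by
  have ha : ApproximatesLinearOn f ((ContinuousLinearEquiv.refl ℝ E : E ≃L[ℝ] E) : E →L[ℝ] E)
      Set.univ c := by
    intro x _ y _
    simpa using hf x y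
  have hcc : Subsingleton E ∨
      c < ‖((ContinuousLinearEquiv.refl ℝ E).symm : E →L[ℝ] E)‖₊⁻¹ := by
    rcases subsingleton_or_nontrivial E with h | h
    · exact Or.inl h
    · right
      have : ((ContinuousLinearEquiv.refl ℝ E).symm : E →L[ℝ] E) = ContinuousLinearMap.id ℝ E := rfl
      rw [this, ContinuousLinearMap.nnnorm_id]
      simpa using hc
  have hi : Function.Injective f := Set.injOn_univ.mp (ha.injOn hcc)
  have hs : Function.Surjective f := ha.surjective hcc
  refine ⟨hi, Set.Subset.antisymm ?_ ?_⟩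
  · rintro _ ⟨x, hx, rfl⟩
    by_contra h
    simp only [mem_ball_zero_iff, not_lt] at h hx
    have := hi (hid _ h)
    rw [this] at h
    linarith
  · intro y hy
    obtain ⟨x, rfl⟩ := hs y
    refine ⟨x, ?_, rfl⟩
    by_contra h
    simp only [mem_ball_zero_iff, not_lt] at h hy
    rw [hid _ h] at hy
    linarith

theorem bn_det_interp (n : ℕ) (v : ℕ → ℝ) (hv : Function.Injective v) :
    ∃ c : ℕ → ℝ, ∑ i ∈ Finset.range (n + 1), c i = 1 ∧
      ∀ A : EuclideanSpace ℝ (Fin n) →L[ℝ] EuclideanSpace ℝ (Fin n),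
        (1 + A).det = ∑ i ∈ Finset.range (n + 1), c i * (1 + v i • A).det := by
  classical
  let c : ℕ → ℝ := fun i => Polynomial.eval 1 (Lagrange.basis (Finset.range (n + 1)) v i)
  refine ⟨c, ?_, ?_⟩
  · have := Lagrange.sum_basis (v := v) (s := Finset.range (n + 1)) (hv.injOn) ⟨0, by simp⟩
    have h2 := congrArg (Polynomial.eval (1 : ℝ)) this
    simpa [Polynomial.eval_finsetSum] using h2
  · intro A
    let b := (EuclideanSpace.basisFun (Fin n) ℝ).toBasis
    let M := LinearMap.toMatrix b b (A : EuclideanSpace ℝ (Fin n) →ₗ[ℝ] EuclideanSpace ℝ (Fin n))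
    let p : Polynomial ℝ := ((Polynomial.X : Polynomial ℝ) • M.map ⇑Polynomial.C + (1 : Matrix (Fin n) (Fin n) ℝ).map ⇑Polynomial.C).det
    have hp : ∀ t : ℝ, (1 + t • A).det = p.eval t := by
      intro t
      have : (1 + t • A).det = (1 + t • M).det := by
        rw [ContinuousLinearMap.det, ← LinearMap.det_toMatrix b]
        congr 1
        simp [M]
      rw [this]
      simp only [p]
      rw [← Polynomial.coe_evalRingHom, RingHom.map_det]
      congr 1
      ext i j
      simp [Matrix.one_apply, add_comm]
      split_ifs <;> simp [mul_comm]
    have hd : p.degree < ((Finset.range (n + 1)).card : WithBot ℕ) := by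
      have := Polynomial.natDegree_det_X_add_C_le M 1
      simp only [Fintype.card_fin] at this
      refine lt_of_le_of_lt Polynomial.degree_le_natDegree ?_
      rw [Finset.card_range]
      exact_mod_cast Nat.lt_succ_of_le this
    have h1 := Lagrange.eq_interpolate (s := Finset.range (n + 1)) (v := v) hv.injOn hd
    have h2 := congrArg (Polynomial.eval (1 : ℝ)) h1
    rw [← hp 1, one_smul] at h2
    rw [h2, Lagrange.interpolate_apply, Polynomial.eval_finsetSum]
    refine Finset.sum_congr rfl fun i _ => ?_
    simp [c, hp, mul_comm]

abbrev BnE (n : ℕ) := EuclideanSpace ℝ (Fin n)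

theorem bn_vol (n : ℕ) (F : BnE n → BnE n)
    (hF : ContDiff ℝ 1 F) (R : ℝ) (hid : ∀ x, ‖x‖ = R → F x = x) :
    ∫ x in Metric.ball 0 R, (fderiv ℝ F x).det =
      (MeasureTheory.volume.real (Metric.ball (0 : BnE n) R)) := by
  let A : BnE n → (BnE n →L[ℝ] BnE n) := fun x => fderiv ℝ F x - 1
  have hAc : Continuous A := (hF.continuous_fderiv one_ne_zero).sub continuous_const
  have hgd : ∀ x, HasFDerivAt (fun x => F x - x) (A x) x := fun x =>
    ((hF.differentiable one_ne_zero) x).hasFDerivAt.sub (hasFDerivAt_id x)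
  obtain ⟨C0, hC0⟩ := (isCompact_closedBall (0 : BnE n) R).exists_bound_of_continuousOn hAc.continuousOn
  let C : NNReal := Real.toNNReal C0
  have hC : ∀ x ∈ Metric.closedBall (0 : BnE n) R, ‖A x‖ ≤ C := fun x hx =>
    (hC0 x hx).trans (Real.le_coe_toNNReal C0)
  have hlip : LipschitzOnWith C (fun x => F x - x) (Metric.closedBall 0 R) :=
    (convex_closedBall (0 : BnE n) R).lipschitzOnWith_of_nnnorm_hasFDerivWithin_le
      (fun x _ => (hgd x).hasFDerivWithinAt) hC
  -- positivity of the determinant near the identity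
  have hdet : ∀ᶠ T : BnE n →L[ℝ] BnE n in 𝓝 1, 0 < T.det := by
    have h1 : ContinuousAt (fun T : BnE n →L[ℝ] BnE n => T.det) 1 :=
      ContinuousLinearMap.continuous_det.continuousAt
    refine h1.eventually (lt_mem_nhds ?_)
    simp [ContinuousLinearMap.det]
  obtain ⟨η, hη, hdet⟩ := Metric.eventually_nhds_iff.mp hdet
  let t0 : ℝ := min 1 η / (C + 1) / 2
  have hC1 : (0 : ℝ) < C + 1 := by positivity
  have ht0 : 0 < t0 := by positivity
  have htC : ∀ t, 0 < t → t ≤ t0 → t * C < 1 ∧ t * C < η := by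
    intro t h1 h2
    have h3 : t * C < min 1 η := by
      calc t * C ≤ t0 * (C + 1) := by gcongr; linarith
        _ = min 1 η / 2 := by simp only [t0]; field_simp
        _ < min 1 η := by have : 0 < min 1 η := by positivity
                          linarith
    exact ⟨h3.trans_le (min_le_left _ _), h3.trans_le (min_le_right _ _)⟩
  have hIntb : ∀ t : ℝ, MeasureTheory.IntegrableOn (fun x => (1 + t • A x).det)
      (Metric.ball (0 : BnE n) R) := by
    intro t
    have hc : Continuous (fun x => (1 + t • A x).det) :=
      ContinuousLinearMap.continuous_det.comp (by fun_prop)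
    exact (hc.continuousOn.integrableOn_compact (isCompact_closedBall (0 : BnE n) R)).mono_set
      Metric.ball_subset_closedBall
  have hsmall : ∀ t, 0 < t → t ≤ t0 → ∫ x in Metric.ball (0 : BnE n) R, (1 + t • A x).det =
      MeasureTheory.volume.real (Metric.ball (0 : BnE n) R) := by
    intro t h1 h2
    obtain ⟨h3, h4⟩ := htC t h1 h2
    let f : BnE n → BnE n := fun x => x + t • (if ‖x‖ ≤ R then F x - x else 0)
    have hfz := bn_zeroExt_lipschitz (fun x => F x - x) R C hlip
      (fun x hx => by simp [hid x hx])
    obtain ⟨hinj, him⟩ := bn_image_ball f R (Real.toNNReal t * C) (by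
        rw [← NNReal.coe_lt_coe]; simpa [h1.le] using h3)
      (fun x y => by
        have : f x - f y - (x - y) = t • ((if ‖x‖ ≤ R then F x - x else 0) -
          (if ‖y‖ ≤ R then F y - y else 0)) := by
            simp only [f]; rw [smul_sub]; abel
        rw [this, norm_smul, Real.norm_eq_abs, abs_of_pos h1]
        calc _ ≤ t * (C * ‖x - y‖) := by gcongr; exact hfz x y
          _ = _ := by simp [mul_assoc, h1.le])
      (fun x hx => by
        simp only [f]
        split_ifs with h
        · rw [hid x (le_antisymm h hx)]; simp
        · simp)
    have hder : ∀ x ∈ Metric.ball (0 : BnE n) R,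
        HasFDerivWithinAt f (1 + t • A x) (Metric.ball (0 : BnE n) R) x := by
      intro x hx
      have h5 : HasFDerivAt (fun x => x + t • (F x - x)) (1 + t • A x) x :=
        (hasFDerivAt_id x).add ((hgd x).const_smul t)
      refine h5.hasFDerivWithinAt.congr ?_ ?_
      · intro y hy
        have : ‖y‖ ≤ R := by simpa using (Metric.ball_subset_closedBall hy)
        simp [f, this]
      · have : ‖x‖ ≤ R := by simpa using (Metric.ball_subset_closedBall hx)
        simp [f, this]
    have := MeasureTheory.integral_image_eq_integral_abs_det_fderiv_smul MeasureTheory.volume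
      Metric.isOpen_ball.measurableSet hder hinj.injOn (fun _ => (1 : ℝ))
    rw [him] at this
    simp only [MeasureTheory.integral_const, smul_eq_mul, mul_one,
      MeasureTheory.measureReal_restrict_apply_univ] at this
    rw [this]
    refine MeasureTheory.setIntegral_congr_fun Metric.isOpen_ball.measurableSet ?_
    intro x hx
    simp only
    rw [abs_of_pos]
    apply hdet
    rw [dist_eq_norm, add_sub_cancel_left, norm_smul, Real.norm_eq_abs, abs_of_pos h1]
    refine lt_of_le_of_lt ?_ h4
    gcongr
    exact hC x (Metric.ball_subset_closedBall hx)
  let v : ℕ → ℝ := fun i => t0 / (i + 1)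
  have hv : Function.Injective v := by
    intro i j hij
    simp only [v] at hij
    have hi : (0 : ℝ) < i + 1 := by positivity
    have hj : (0 : ℝ) < j + 1 := by positivity
    field_simp at hij
    have : (i : ℝ) = j := by linarith
    exact_mod_cast this
  obtain ⟨c, hc1, hc2⟩ := bn_det_interp n v hv
  have e1 : ∀ x, (fderiv ℝ F x).det = ∑ i ∈ Finset.range (n + 1), c i * (1 + v i • A x).det := by
    intro x
    rw [← hc2]
    simp [A]
  simp_rw [e1]
  rw [MeasureTheory.integral_finsetSum _ (fun i _ => (hIntb (v i)).const_mul (c i))]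
  have e2 : ∀ i ∈ Finset.range (n + 1), ∫ x in Metric.ball (0 : BnE n) R, c i * (1 + v i • A x).det =
      c i * MeasureTheory.volume.real (Metric.ball (0 : BnE n) R) := by
    intro i _
    rw [MeasureTheory.integral_const_mul, hsmall]
    · positivity
    · exact div_le_self ht0.le (by simp)
  rw [Finset.sum_congr rfl e2, ← Finset.sum_mul, hc1, one_mul]

theorem bn_no_retraction (n : ℕ) (F : BnE n → BnE n)
    (hF : ContDiff ℝ 1 F) (R : ℝ) (hR : 0 < R) (hid : ∀ x, ‖x‖ = R → F x = x)
    (hnorm : ∀ x, ‖F x‖ = R) : False := by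
  have h := bn_vol n F hF R hid
  have h0 : ∀ x, (fderiv ℝ F x).det = 0 := by
    intro x
    by_contra hne
    have hd := ((hF.differentiable one_ne_zero) x).hasFDerivAt
    have h1 : HasFDerivAt (fun x => inner ℝ (F x) (F x)) _ x := hd.inner ℝ hd
    have h2 : (fun x => inner ℝ (F x) (F x)) = fun _ => R ^ 2 := by
      funext y; rw [real_inner_self_eq_norm_sq, hnorm]
    rw [h2] at h1
    have h3 := h1.unique (hasFDerivAt_const _ _)
    have hu : IsUnit (LinearMap.det (fderiv ℝ F x : BnE n →ₗ[ℝ] _)) :=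
      isUnit_iff_ne_zero.mpr hne
    obtain ⟨w, hw⟩ := (LinearEquiv.ofIsUnitDet (f := (fderiv ℝ F x : BnE n →ₗ[ℝ] _))
      (v := (EuclideanSpace.basisFun (Fin n) ℝ).toBasis) (v' := (EuclideanSpace.basisFun (Fin n) ℝ).toBasis)
      (by rw [LinearMap.det_toMatrix]; exact hu)).surjective (F x)
    have hw' : fderiv ℝ F x w = F x := hw
    have h4 := congrArg (fun T => T w) h3
    simp [hw', fderivInnerCLM_apply] at h4
    have := hnorm x
    rw [h4] at this
    simp at this
    linarith
  simp only [h0, MeasureTheory.integral_zero] at h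
  have : 0 < MeasureTheory.volume.real (Metric.ball (0 : BnE n) R) :=
    ENNReal.toReal_pos (Metric.measure_ball_pos _ _ hR).ne' MeasureTheory.measure_ball_lt_top.ne
  linarith

theorem bn_brouwer_euclid (n : ℕ) (g : BnE n → BnE n)
    (hg : Continuous g) (M : ℝ) (hM : ∀ x, ‖g x‖ ≤ M) : ∃ x, g x = x := by
  by_contra! hno
  let R := max M 1
  have hR : 0 < R := lt_of_lt_of_le one_pos (le_max_right _ _)
  have hM' : ∀ x, ‖g x‖ ≤ R := fun x => (hM x).trans (le_max_left _ _)
  let χ : ContDiffBump (0 : BnE n) := ⟨R, 2 * R, hR, by linarith⟩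
  let f : BnE n → BnE n := fun x => x - χ x • g x
  have hfc : Continuous f := continuous_id.sub (χ.continuous.smul hg)
  have hfid : ∀ x, 2 * R ≤ ‖x‖ → f x = x := by
    intro x hx
    have : χ x = 0 := χ.zero_of_le_dist (by simpa using hx)
    simp [f, this]
  have hf0 : ∀ x, f x ≠ 0 := by
    intro x hx
    have hx' : x = χ x • g x := sub_eq_zero.mp hx
    by_cases h : ‖x‖ ≤ R
    · have : χ x = 1 := χ.one_of_mem_closedBall (by simpa using h)
      rw [this, one_smul] at hx'
      exact hno x hx'.symm
    · have h1 : ‖x‖ ≤ 1 * R := by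
        calc ‖x‖ = ‖χ x • g x‖ := by rw [← hx']
          _ = χ x * ‖g x‖ := by rw [norm_smul, Real.norm_eq_abs, abs_of_nonneg χ.nonneg]
          _ ≤ 1 * R := by gcongr; exacts [χ.le_one, hM' x]
      linarith
  obtain ⟨k, hk, hkd, hkS, -⟩ := hfc.exists_contDiff_approx_and_eqOn 1 (ε := fun x => ‖f x‖)
    hfc.norm (fun x => norm_pos_iff.mpr (hf0 x)) (S := {x | 3 * R ≤ ‖x‖}) (U := {x | 2 * R < ‖x‖})
    (isClosed_le continuous_const continuous_norm)
    ((isOpen_lt continuous_const continuous_norm).mem_nhdsSet.mpr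
      (fun x hx => by simp only [Set.mem_ofPred_eq] at *; linarith))
    (contDiffOn_id.congr (fun x hx => hfid x (le_of_lt hx)))
  have hk0 : ∀ x, k x ≠ 0 := by
    intro x hx
    have := hkd x
    simp [hx] at this
  refine bn_no_retraction n (fun x => (3 * R / ‖k x‖) • k x) ?_ (3 * R) (by positivity) ?_ ?_
  · have hk1 : ContDiff ℝ 1 k := by exact_mod_cast hk
    exact (contDiff_const.div (hk1.norm ℝ hk0) (fun x => norm_ne_zero_iff.mpr (hk0 x))).smul hk1
  · intro x hx
    have : k x = x := by rw [hkS (show x ∈ {x : BnE n | 3 * R ≤ ‖x‖} from hx.ge), hfid]; linarith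
    simp only [this, hx]
    rw [div_self (by positivity), one_smul]
  · intro x
    have := norm_ne_zero_iff.mpr (hk0 x)
    rw [norm_smul, norm_div, norm_norm, div_mul_cancel₀ _ this, Real.norm_eq_abs, abs_of_pos]
    positivity

theorem bn_brouwer {E : Type*} [NormedAddCommGroup E] [NormedSpace ℝ E] [FiniteDimensional ℝ E]
    (g : E → E) (hg : Continuous g) (M : ℝ) (hM : ∀ x, ‖g x‖ ≤ M) : ∃ x, g x = x := by
  let e := toEuclidean (E := E)
  obtain ⟨x, hx⟩ := bn_brouwer_euclid _ (fun y => e (g (e.symm y)))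
    (e.continuous.comp (hg.comp e.symm.continuous)) (‖(e : E →L[ℝ] BnE (Module.finrank ℝ E))‖ * M) (fun y => by
      refine ((e : E →L[ℝ] BnE (Module.finrank ℝ E)).le_opNorm _).trans ?_
      gcongr; exact hM _)
  refine ⟨e.symm x, ?_⟩
  apply e.injective
  simpa using hx

theorem bn_ekeland {Y : Type*} [MetricSpace Y] [CompleteSpace Y] (A : Set Y) (hA : IsClosed A)
    (Φ : Y → ℝ) (hΦ : LowerSemicontinuous Φ) (m : ℝ) (hm : ∀ y, m ≤ Φ y) (b : ℝ) (hb : 0 < b)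
    (y0 : Y) (hy0 : y0 ∈ A) :
    ∃ y ∈ A, Φ y + b * dist y y0 ≤ Φ y0 ∧ ∀ z ∈ A, Φ z + b * dist z y ≤ Φ y → z = y := by
  let S : Y → Set Y := fun y => {z | z ∈ A ∧ Φ z + b * dist z y ≤ Φ y}
  have hSclosed : ∀ y, IsClosed (S y) := by
    intro y
    have h1 : LowerSemicontinuous (fun z => Φ z + b * dist z y) :=
      hΦ.add (by fun_prop : Continuous fun z => b * dist z y).lowerSemicontinuous
    exact hA.inter (h1.isClosed_preimage (Φ y))
  have hSself : ∀ y ∈ A, y ∈ S y := fun y hy => ⟨hy, by simp⟩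
  have hStrans : ∀ x y z, y ∈ S x → z ∈ S y → z ∈ S x := by
    rintro x y z ⟨_, h1⟩ ⟨hz, h2⟩
    refine ⟨hz, ?_⟩
    have := dist_triangle z y x
    nlinarith
  have hbdd : ∀ y, BddBelow (Φ '' S y) := fun y => ⟨m, by rintro _ ⟨z, _, rfl⟩; exact hm z⟩
  have hnext : ∀ (n : ℕ) (y : A), ∃ z : A, (z : Y) ∈ S y ∧
      Φ z < sInf (Φ '' S y) + 1 / ((n : ℝ) + 1) := by
    intro n y
    have hne : (Φ '' S y).Nonempty := ⟨_, y, hSself y y.2, rfl⟩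
    obtain ⟨_, ⟨z, hz, rfl⟩, h⟩ := exists_lt_of_csInf_lt hne
      (show sInf (Φ '' S y) < sInf (Φ '' S y) + 1 / ((n : ℝ) + 1) by
        have : 0 < 1 / ((n : ℝ) + 1) := by positivity
        linarith)
    exact ⟨⟨z, hz.1⟩, hz, h⟩
  choose nx hnx1 hnx2 using hnext
  obtain ⟨x, hx0, hxs⟩ : ∃ x : ℕ → A, x 0 = ⟨y0, hy0⟩ ∧ ∀ n, x (n + 1) = nx n (x n) :=
    ⟨fun n => Nat.rec ⟨y0, hy0⟩ nx n, rfl, fun _ => rfl⟩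
  have hxS : ∀ n k : ℕ, (x (n + k)).1 ∈ S (x n).1 := by
    intro n k
    induction k with
    | zero => exact hSself _ (x n).2
    | succ k ih =>
      refine hStrans _ _ _ ih ?_
      rw [← add_assoc, hxs]
      exact hnx1 _ _
  have hdist : ∀ n, ∀ z ∈ S (x (n + 1)), dist z (x (n + 1)) ≤ 1 / ((n : ℝ) + 1) / b := by
    intro n z hz
    have h1 : sInf (Φ '' S (x n)) ≤ Φ z :=
      csInf_le (hbdd _) ⟨z, hStrans _ _ _ (by rw [hxs]; exact hnx1 _ _) hz, rfl⟩
    have h2 := hnx2 n (x n)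
    rw [← hxs] at h2
    rw [le_div_iff₀ hb]
    have := hz.2
    linarith
  have hlim : Tendsto (fun n : ℕ => 1 / ((n : ℝ) + 1) / b) atTop (𝓝 0) := by
    simpa using tendsto_one_div_add_atTop_nhds_zero_nat.div_const b
  have hcau : CauchySeq (fun n => (x (n + 1) : Y)) := by
    refine cauchySeq_of_le_tendsto_0' (fun n : ℕ => 1 / ((n : ℝ) + 1) / b) ?_ hlim
    intro n k hnk
    obtain ⟨j, rfl⟩ := Nat.exists_eq_add_of_le hnk
    rw [dist_comm]
    apply hdist
    have := hxS (n + 1) j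
    rwa [show n + 1 + j = n + j + 1 by ring] at this
  obtain ⟨y, hy⟩ := cauchySeq_tendsto_of_complete hcau
  have hyS : ∀ n, y ∈ S (x n) := by
    intro n
    refine (hSclosed _).mem_of_tendsto hy ?_
    filter_upwards [eventually_ge_atTop n] with k hk
    obtain ⟨j, rfl⟩ := Nat.exists_eq_add_of_le hk
    exact hxS n (j + 1)
  refine ⟨y, (hyS 0).1, ?_, ?_⟩
  · have := (hyS 0).2
    rwa [hx0] at this
  · intro z hz hzy
    have hzS : ∀ n, z ∈ S (x n) := fun n => hStrans _ _ _ (hyS n) ⟨hz, hzy⟩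
    have h1 : Tendsto (fun n => (x (n + 1) : Y)) atTop (𝓝 z) := by
      rw [tendsto_iff_dist_tendsto_zero]
      refine squeeze_zero (fun _ => dist_nonneg) (fun n => ?_) hlim
      rw [dist_comm]
      exact hdist n z (hzS _)
    exact tendsto_nhds_unique h1 hy

section BN
variable {X : Type*} [NormedAddCommGroup X] [NormedSpace ℝ X]

theorem bn_descend {K : Type*} [TopologicalSpace K] [CompactSpace K]
    (J : X → ℝ) (hJ : ContDiff ℝ 1 J) (θ : X → ℝ) (a : ℝ)
    (hθc : Continuous θ) (hθ : ∀ x y, θ x - θ y ≤ a * ‖x - y‖) (ha : 0 ≤ a)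
    (f w : C(K, X)) (hw : ∀ ξ, ‖w ξ‖ ≤ 1) (M σ : ℝ) (hM : ∀ ξ, J (f ξ) + θ (f ξ) ≤ M)
    (hD : ∀ ξ, J (f ξ) + θ (f ξ) = M → σ < fderiv ℝ J (f ξ) (w ξ)) :
    ∀ᶠ t : ℝ in 𝓝[>] 0, ∀ ξ, J (f ξ - t • w ξ) + θ (f ξ - t • w ξ) < M - (σ - a) * t := by
  have hJc := hJ.continuous
  have loc : ∀ ξ : K, ∀ᶠ p : K × ℝ in 𝓝 ξ ×ˢ 𝓝[>] (0 : ℝ),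
      J (f p.1 - p.2 • w p.1) + θ (f p.1 - p.2 • w p.1) < M - (σ - a) * p.2 := by
    intro ξ
    have hle : 𝓝 ξ ×ˢ 𝓝[>] (0 : ℝ) ≤ 𝓝 (ξ, (0 : ℝ)) := by
      rw [nhds_prod_eq]; exact Filter.prod_mono le_rfl nhdsWithin_le_nhds
    rcases (hM ξ).lt_or_eq with h | h
    · refine hle ?_
      have h1 : ContinuousAt (fun p : K × ℝ => J (f p.1 - p.2 • w p.1) + θ (f p.1 - p.2 • w p.1))
        (ξ, 0) := by fun_prop
      have h2 : ContinuousAt (fun p : K × ℝ => M - (σ - a) * p.2) (ξ, 0) := by fun_prop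
      exact h1.eventually_lt h2 (by simpa using h)
    · set L := fderiv ℝ J (f ξ)
      have hL : σ < L (w ξ) := hD ξ h
      have hst : HasStrictFDerivAt J L (f ξ) := hJ.contDiffAt.hasStrictFDerivAt one_ne_zero
      set ε := (L (w ξ) - σ) / 2 with hε
      have hε0 : 0 < ε := by rw [hε]; linarith
      have hst2 := hst.isLittleO.def hε0
      have ht : Tendsto (fun p : K × ℝ => (f p.1 - p.2 • w p.1, f p.1)) (𝓝 (ξ, (0 : ℝ)))
          (𝓝 (f ξ, f ξ)) := by
        have h1 : ContinuousAt (fun p : K × ℝ => (f p.1 - p.2 • w p.1, f p.1)) (ξ, 0) := by fun_prop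
        simpa [ContinuousAt] using h1
      have h3 := hle (ht.eventually hst2)
      have h4 : ∀ᶠ p : K × ℝ in 𝓝 (ξ, (0 : ℝ)), σ + ε < L (w p.1) := by
        have h1 : ContinuousAt (fun p : K × ℝ => L (w p.1)) (ξ, 0) := by fun_prop
        exact h1.eventually (lt_mem_nhds (by simp only; rw [hε]; linarith))
      have h5 : ∀ᶠ p : K × ℝ in 𝓝 ξ ×ˢ 𝓝[>] (0 : ℝ), 0 < p.2 :=
        tendsto_snd.eventually self_mem_nhdsWithin
      filter_upwards [h3, hle h4, h5] with p h3 h4 h5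
      have e1 : f p.1 - p.2 • w p.1 - f p.1 = -(p.2 • w p.1) := by abel
      have e2 : ‖p.2 • w p.1‖ ≤ p.2 := by
        rw [norm_smul, Real.norm_eq_abs, abs_of_pos h5]
        exact mul_le_of_le_one_right h5.le (hw _)
      have e3 := hθ (f p.1 - p.2 • w p.1) (f p.1)
      rw [e1, norm_neg] at e3
      simp only [e1, norm_neg, map_neg, map_smul, smul_eq_mul] at h3
      have e4 := le_of_abs_le h3
      have e5 := hM p.1
      have e6 : a * ‖p.2 • w p.1‖ ≤ a * p.2 := by gcongr
      have e7 : ε * ‖p.2 • w p.1‖ ≤ ε * p.2 := by gcongr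
      have e8 : p.2 * (σ + ε) < p.2 * L (w p.1) := by gcongr
      nlinarith
  have := isCompact_univ (X := K).induction_on
    (p := fun s => ∀ᶠ t : ℝ in 𝓝[>] 0, ∀ ξ ∈ s,
      J (f ξ - t • w ξ) + θ (f ξ - t • w ξ) < M - (σ - a) * t)
    (by simp) (fun s t hst h => h.mono fun x hx ξ hξ => hx ξ (hst hξ))
    (fun s t hs ht => by
      filter_upwards [hs, ht] with x h1 h2 ξ hξ
      exact hξ.elim (h1 ξ) (h2 ξ))
    (fun ξ _ => by
      obtain ⟨pa, hpa, pb, hpb, h⟩ := Filter.eventually_prod_iff.mp (loc ξ)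
      refine ⟨{x | pa x}, mem_nhdsWithin_of_mem_nhds hpa, ?_⟩
      filter_upwards [hpb] with t ht ξ' hξ'
      exact h hξ' ht)
  simpa using this

theorem bn_exists_dir (L : X →L[ℝ] ℝ) (σ : ℝ) (h : σ < ‖L‖) :
    ∃ v, ‖v‖ ≤ 1 ∧ σ < L v := by
  obtain ⟨v, hv, hL⟩ := L.exists_lt_apply_of_lt_opNorm h
  rw [Real.norm_eq_abs] at hL
  rcases le_total 0 (L v) with h0 | h0
  · exact ⟨v, hv.le, by rwa [abs_of_nonneg h0] at hL⟩
  · exact ⟨-v, by simpa using hv.le, by rw [abs_of_nonpos h0] at hL; simpa using hL⟩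

theorem bn_select {K : Type*} [TopologicalSpace K] [CompactSpace K] [T2Space K]
    (J : X → ℝ) (hJ : ContDiff ℝ 1 J) (f : C(K, X)) (K0 D D' : Set K)
    (hDc : IsClosed D) (hDc' : IsClosed D') (hK0 : IsClosed K0) (σ : ℝ) (hσ : 0 ≤ σ)
    (hD : ∀ ξ ∈ D, ξ ∉ K0 ∧ σ < ‖fderiv ℝ J (f ξ)‖)
    (hD' : ∀ ξ ∈ D', ξ ∉ K0 ∧ fderiv ℝ J (f ξ) ≠ 0) :
    ∃ w : C(K, X), (∀ ξ, ‖w ξ‖ ≤ 1) ∧ (∀ ξ ∈ K0, w ξ = 0) ∧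
      (∀ ξ ∈ D, σ < fderiv ℝ J (f ξ) (w ξ)) ∧ (∀ ξ ∈ D', 0 < fderiv ℝ J (f ξ) (w ξ)) := by
  have hJc : Continuous (fun ξ => fderiv ℝ J (f ξ)) :=
    (hJ.continuous_fderiv one_ne_zero).comp f.continuous
  have hev : ∀ (v : X) (s : ℝ) (ξ : K), s < fderiv ℝ J (f ξ) v →
      ∀ᶠ y in 𝓝 ξ, s < fderiv ℝ J (f y) v := by
    intro v s ξ h
    have : Continuous (fun ξ => fderiv ℝ J (f ξ) v) := hJc.clm_apply continuous_const
    exact this.continuousAt.eventually (lt_mem_nhds h)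
  let T : K → Set X := fun ξ => {v : X | ‖v‖ ≤ 1 ∧ (ξ ∈ K0 → v = 0) ∧
      (ξ ∈ D → σ < fderiv ℝ J (f ξ) v) ∧ (ξ ∈ D' → 0 < fderiv ℝ J (f ξ) v)}
  have hconv : ∀ ξ, Convex ℝ (T ξ) := by
    rintro ξ x ⟨h1, h2, h3, h4⟩ y ⟨k1, k2, k3, k4⟩ s t hs ht hst
    refine ⟨?_, fun h => by simp [h2 h, k2 h], fun h => ?_, fun h => ?_⟩
    · calc _ ≤ ‖s • x‖ + ‖t • y‖ := norm_add_le _ _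
        _ = s * ‖x‖ + t * ‖y‖ := by simp [norm_smul, abs_of_nonneg hs, abs_of_nonneg ht]
        _ ≤ s * 1 + t * 1 := by gcongr
        _ = 1 := by linarith
    · exact (convex_halfSpace_gt (f := fderiv ℝ J (f ξ)) (fderiv ℝ J (f ξ)).toLinearMap.isLinear σ)
        (h3 h) (k3 h) hs ht hst
    · exact (convex_halfSpace_gt (f := fderiv ℝ J (f ξ)) (fderiv ℝ J (f ξ)).toLinearMap.isLinear 0)
        (h4 h) (k4 h) hs ht hst
  have hloc : ∀ ξ, ∃ c, ∀ᶠ y in 𝓝 ξ, c ∈ T y := by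
    intro ξ
    by_cases h0 : ξ ∈ K0
    · have n1 : ξ ∉ D := fun h => (hD ξ h).1 h0
      have n2 : ξ ∉ D' := fun h => (hD' ξ h).1 h0
      refine ⟨0, ?_⟩
      filter_upwards [hDc.isOpen_compl.mem_nhds n1, hDc'.isOpen_compl.mem_nhds n2] with y h1 h2
      exact ⟨by simp, fun _ => rfl, fun h => absurd h h1, fun h => absurd h h2⟩
    · have hk := hK0.isOpen_compl.mem_nhds h0
      by_cases h1 : ξ ∈ D
      · obtain ⟨v, hv, hvL⟩ := bn_exists_dir _ σ (hD ξ h1).2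
        refine ⟨v, ?_⟩
        filter_upwards [hk, hev v σ ξ hvL] with y y1 y2
        exact ⟨hv, fun h => absurd h y1, fun _ => y2, fun _ => hσ.trans_lt y2⟩
      · have hk1 := hDc.isOpen_compl.mem_nhds h1
        by_cases h2 : ξ ∈ D'
        · obtain ⟨v, hv, hvL⟩ := bn_exists_dir _ 0 (norm_pos_iff.mpr (hD' ξ h2).2)
          refine ⟨v, ?_⟩
          filter_upwards [hk, hk1, hev v 0 ξ hvL] with y y1 y3 y2
          exact ⟨hv, fun h => absurd h y1, fun h => absurd h y3, fun _ => y2⟩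
        · refine ⟨0, ?_⟩
          filter_upwards [hk, hk1, hDc'.isOpen_compl.mem_nhds h2] with y y1 y2 y3
          exact ⟨by simp, fun _ => rfl, fun h => absurd h y2, fun h => absurd h y3⟩
  obtain ⟨w, hw⟩ := exists_continuous_forall_mem_convex_of_local_const hconv hloc
  exact ⟨w, fun ξ => (hw ξ).1, fun ξ => (hw ξ).2.1, fun ξ => (hw ξ).2.2.1,
      fun ξ => (hw ξ).2.2.2⟩

end BN

section BN2
variable {X : Type*} [NormedAddCommGroup X] [NormedSpace ℝ X]

theorem bn_deform [CompleteSpace X] {K : Type*} [TopologicalSpace K] [CompactSpace K] [T2Space K]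
    [Nonempty K]
    (J : X → ℝ) (hJ : ContDiff ℝ 1 J) (m : ℝ) (hm : ∀ x, m ≤ J x) (θ : X → ℝ) (a : ℝ)
    (hθc : Continuous θ) (hθ : ∀ x y, θ x - θ y ≤ a * ‖x - y‖) (ha : 0 ≤ a) (hθ0 : ∀ x, 0 ≤ θ x)
    (K0 : Set K) (hK0 : IsClosed K0) (A : Set C(K, X)) (M0 l α : ℝ) (hα : a < α)
    (hAc : IsClosed (A ∩ {f : C(K, X) | ∀ ξ, J (f ξ) ≤ M0}))
    (hstab : ∀ f ∈ A, (∀ ξ, J (f ξ) ≤ M0) → ∀ w : C(K, X), (∀ ξ ∈ K0, w ξ = 0) →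
      ∀ᶠ t : ℝ in 𝓝[>] 0, f - t • w ∈ A)
    (htop : ∀ f ∈ A, (∀ ξ, J (f ξ) ≤ M0) → ∀ ξ, J (f ξ) = M0 →
      ξ ∉ K0 ∧ fderiv ℝ J (f ξ) ≠ 0)
    (hreg : ∀ f ∈ A, (∀ ξ, J (f ξ) ≤ M0) → ∀ ξ, l ≤ J (f ξ) + θ (f ξ) →
      ξ ∉ K0 ∧ α ≤ ‖fderiv ℝ J (f ξ)‖)
    (f0 : C(K, X)) (hf0 : f0 ∈ A) (hf0M : ∀ ξ, J (f0 ξ) ≤ M0) :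
    ∃ f ∈ A, (∀ ξ, J (f ξ) ≤ M0) ∧ ∀ ξ, J (f ξ) + θ (f ξ) < l := by
  have hJc := hJ.continuous
  let G : X → ℝ := fun x => J x + θ x
  have hG : Continuous G := hJc.add hθc
  let Φ : C(K, X) → ℝ := fun f => ⨆ ξ, G (f ξ)
  have hbdd : ∀ f : C(K, X), BddAbove (Set.range fun ξ => G (f ξ)) := fun f =>
    (isCompact_range (hG.comp f.continuous)).bddAbove
  have hΦ : LowerSemicontinuous Φ := by
    refine lowerSemicontinuous_ciSup hbdd (fun ξ => ?_)
    exact (hG.comp (by fun_prop : Continuous fun f : C(_, X) => f ξ)).lowerSemicontinuous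
  have hΦm : ∀ f, m ≤ Φ f := by
    intro f
    obtain ⟨ξ⟩ := ‹Nonempty K›
    refine le_trans ?_ (le_ciSup (hbdd f) ξ)
    have := hm (f ξ); have := hθ0 (f ξ)
    simp only [G]; linarith
  set b := (α - a) / 2 with hb
  have hb0 : 0 < b := by rw [hb]; linarith
  obtain ⟨f, ⟨hfA, hfM⟩, -, hmin⟩ := bn_ekeland _ hAc Φ hΦ m hΦm b hb0 f0 ⟨hf0, hf0M⟩
  refine ⟨f, hfA, hfM, ?_⟩
  by_contra! hcon
  obtain ⟨ξ1, hξ1⟩ := hcon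
  have hle : ∀ ξ, J (f ξ) + θ (f ξ) ≤ Φ f := fun ξ => le_ciSup (hbdd f) ξ
  set σ := a + 3 / 4 * (α - a) with hσ
  obtain ⟨w, hw1, hw0, hwD, hwD'⟩ := bn_select J hJ f K0 {ξ | J (f ξ) + θ (f ξ) = Φ f}
    {ξ | J (f ξ) = M0} (isClosed_eq (by fun_prop) continuous_const)
    (isClosed_eq (by fun_prop) continuous_const) hK0 σ (by rw [hσ]; linarith)
    (fun ξ hξ => by
      obtain ⟨h1, h2⟩ := hreg f hfA hfM ξ (by
        rw [show J (f ξ) + θ (f ξ) = Φ f from hξ]; exact hξ1.trans (hle ξ1))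
      exact ⟨h1, lt_of_lt_of_le (by rw [hσ]; linarith) h2⟩)
    (fun ξ hξ => htop f hfA hfM ξ hξ)
  have e1 := bn_descend J hJ θ a hθc hθ ha f w hw1 (Φ f) σ hle (fun ξ h => hwD ξ h)
  have e2 := bn_descend J hJ (fun _ => 0) 0 continuous_const (by simp) le_rfl f w hw1 M0 0
    (by simpa using hfM) (fun ξ h => hwD' ξ (by simpa using h))
  have e3 := hstab f hfA hfM w hw0
  have e4 : ∀ᶠ t : ℝ in 𝓝[>] 0, 0 < t := self_mem_nhdsWithin
  obtain ⟨t, t1, t2, t3, t4⟩ := (e1.and (e2.and (e3.and e4))).exists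
  have hΦg : Φ (f - t • w) ≤ Φ f - (σ - a) * t := ciSup_le fun ξ => (t1 ξ).le
  have hd : dist (f - t • w) f ≤ t := by
    rw [dist_eq_norm, sub_sub_cancel_left, norm_neg, norm_smul, Real.norm_eq_abs, abs_of_pos t4]
    refine mul_le_of_le_one_right t4.le ?_
    exact (ContinuousMap.norm_le _ zero_le_one).mpr hw1
  have hbt : b * dist (f - t • w) f ≤ b * t := by gcongr
  have := hmin (f - t • w) ⟨t3, fun ξ => by have := (t2 ξ).le; simpa using this⟩ (by
    have : (σ - a) * t = b * t + (α - a) / 4 * t := by rw [hσ, hb]; ring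
    have : 0 < (α - a) / 4 * t := mul_pos (by linarith) t4
    linarith)
  rw [this] at hΦg
  have : 0 < (σ - a) * t := mul_pos (by rw [hσ]; linarith) t4
  linarith

theorem bn_reg (J : X → ℝ) (hJ : ContDiff ℝ 1 J)
    (hPS : ∀ u : ℕ → X, (∃ M : ℝ, ∀ n, |J (u n)| ≤ M) →
      Tendsto (fun n => ‖fderiv ℝ J (u n)‖) atTop (nhds 0) →
      ∃ (v : X) (φ : ℕ → ℕ), StrictMono φ ∧ Tendsto (u ∘ φ) atTop (nhds v))
    (Z : Set X) (hZ : IsClosed Z) (M : ℝ) (hM : ∀ u ∈ Z, |J u| ≤ M)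
    (hcr : ∀ u ∈ Z, fderiv ℝ J u ≠ 0) : ∃ α > 0, ∀ u ∈ Z, α ≤ ‖fderiv ℝ J u‖ := by
  by_contra! h
  have : ∀ n : ℕ, ∃ u ∈ Z, ‖fderiv ℝ J u‖ < 1 / ((n : ℝ) + 1) := fun n => h _ (by positivity)
  choose u hu1 hu2 using this
  have hlim : Tendsto (fun n => ‖fderiv ℝ J (u n)‖) atTop (nhds 0) :=
    squeeze_zero (fun _ => norm_nonneg _) (fun n => (hu2 n).le)
      tendsto_one_div_add_atTop_nhds_zero_nat
  obtain ⟨v, φ, hφ, hv⟩ := hPS u ⟨M, fun n => hM _ (hu1 n)⟩ hlim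
  have hvZ : v ∈ Z := hZ.mem_of_tendsto hv (Eventually.of_forall fun n => hu1 _)
  apply hcr v hvZ
  have h1 : Tendsto (fun n => ‖fderiv ℝ J ((u ∘ φ) n)‖) atTop (nhds ‖fderiv ℝ J v‖) :=
    (((hJ.continuous_fderiv one_ne_zero).norm.tendsto v).comp hv)
  have h2 : Tendsto (fun n => ‖fderiv ℝ J ((u ∘ φ) n)‖) atTop (nhds 0) :=
    hlim.comp hφ.tendsto_atTop
  exact norm_eq_zero.mp (tendsto_nhds_unique h1 h2)

theorem bn_exists_crit [CompleteSpace X] (J : X → ℝ) (hJ : ContDiff ℝ 1 J)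
    (hPS : ∀ u : ℕ → X, (∃ M : ℝ, ∀ n, |J (u n)| ≤ M) →
      Tendsto (fun n => ‖fderiv ℝ J (u n)‖) atTop (nhds 0) →
      ∃ (v : X) (φ : ℕ → ℕ), StrictMono φ ∧ Tendsto (u ∘ φ) atTop (nhds v))
    (m : ℝ) (hm : ∀ x, m ≤ J x) (w : X) : ∃ u, J u ≤ J w ∧ fderiv ℝ J u = 0 := by
  by_contra! h
  have hJc := hJ.continuous
  obtain ⟨α, hα, hreg⟩ := bn_reg J hJ hPS {u | J u ≤ J w} (isClosed_le hJc continuous_const)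
    (|m| + |J w|) (fun u hu => by
      have h1 := hm u
      have h2 : J u ≤ J w := hu
      rw [abs_le]
      constructor <;> cases abs_cases m <;> cases abs_cases (J w) <;> linarith)
    (fun u hu => h u hu)
  obtain ⟨f, -, -, hf⟩ := bn_deform (K := Unit) J hJ m hm (fun _ => 0) 0 continuous_const (by simp) le_rfl
    (by simp) ∅ isClosed_empty Set.univ (J w) m α hα
    (by
      rw [Set.univ_inter]
      have : {f : C(Unit, X) | ∀ ξ, J (f ξ) ≤ J w} = ⋂ ξ, {f : C(Unit, X) | J (f ξ) ≤ J w} := by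
        ext; simp
      rw [this]
      exact isClosed_iInter fun ξ =>
        isClosed_le (hJc.comp (by fun_prop : Continuous fun f : C(_, X) => f ξ)) continuous_const)
    (by simp) (fun f _ hf ξ _ => ⟨by simp, h _ (hf ξ)⟩)
    (fun f _ hf ξ _ => ⟨by simp, hreg _ (hf ξ)⟩) (ContinuousMap.const _ w) trivial (by simp)
  have := hf ()
  have := hm (f ())
  simp at *
  linarith

theorem bn_loc [CompleteSpace X] (J : X → ℝ) (hJ : ContDiff ℝ 1 J)
    (hPS : ∀ u : ℕ → X, (∃ M : ℝ, ∀ n, |J (u n)| ≤ M) →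
      Tendsto (fun n => ‖fderiv ℝ J (u n)‖) atTop (nhds 0) →
      ∃ (v : X) (φ : ℕ → ℕ), StrictMono φ ∧ Tendsto (u ∘ φ) atTop (nhds v))
    (u0 : X) (hm : ∀ x, J u0 ≤ J x) (h0 : J u0 < 0)
    (hcr : ∀ u, J u < 0 → fderiv ℝ J u = 0 → u = u0) (δ : ℝ) (hδ : 0 < δ) :
    ∃ η > 0, ∀ u, J u ≤ J u0 + η → ‖u - u0‖ < δ := by
  have hJc := hJ.continuous
  obtain ⟨α, hα, hreg⟩ := bn_reg J hJ hPS {u | J u ≤ J u0 / 2 ∧ δ / 2 ≤ ‖u - u0‖}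
    ((isClosed_le hJc continuous_const).inter (isClosed_le continuous_const (continuous_id.sub continuous_const).norm))
    (-J u0) (fun u hu => by
      have h1 := hm u
      have h2 := hu.1
      rw [abs_le]
      constructor <;> linarith)
    (fun u hu hc => by
      have := hcr u (by have := hu.1; linarith) hc
      have h2 := hu.2
      rw [this, sub_self, norm_zero] at h2
      linarith)
  refine ⟨min (-J u0 / 2) (α * δ / 8), lt_min (by linarith) (by positivity), ?_⟩
  intro u hu
  have hu1 := hu.trans (add_le_add_right (min_le_left _ _) _)
  have hu2 := hu.trans (add_le_add_right (min_le_right _ _) _)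
  by_contra! hfar
  obtain ⟨v, -, hv1, hv2⟩ := bn_ekeland (Set.univ : Set X) isClosed_univ J hJc.lowerSemicontinuous
    (J u0) hm (α / 2) (by positivity) u trivial
  have hd : dist v u ≤ δ / 4 := by
    have := hm v
    have : α / 2 * dist v u ≤ α / 2 * (δ / 4) := by linarith
    exact le_of_mul_le_mul_left this (by positivity)
  have hvZ : δ / 2 ≤ ‖v - u0‖ := by
    have := dist_triangle u v u0
    rw [dist_eq_norm u u0, dist_eq_norm v u0, dist_comm u v] at this
    linarith
  have hvJ : J v ≤ J u0 / 2 := by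
    have : 0 ≤ α / 2 * dist v u := by positivity
    linarith
  have hvα := hreg v ⟨hvJ, hvZ⟩
  obtain ⟨y, hy1, hy2⟩ := bn_exists_dir (fderiv ℝ J v) (α / 2) (by linarith)
  have e1 := bn_descend (K := Unit) J hJ (fun _ => 0) 0 continuous_const (by simp) le_rfl
    (ContinuousMap.const _ v) (ContinuousMap.const _ y) (by simpa using hy1) (J v) (α / 2)
    (by simp) (by simpa using hy2)
  have e4 : ∀ᶠ t : ℝ in 𝓝[>] 0, 0 < t := self_mem_nhdsWithin
  obtain ⟨t, t1, t2⟩ := (e1.and e4).exists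
  have t1 := t1 ()
  simp at t1
  have hd : dist (v - t • y) v ≤ t := by
    rw [dist_eq_norm, sub_sub_cancel_left, norm_neg, norm_smul, Real.norm_eq_abs, abs_of_pos t2]
    exact mul_le_of_le_one_right t2.le hy1
  have hbt : α / 2 * dist (v - t • y) v ≤ α / 2 * t := by gcongr
  have := hv2 (v - t • y) trivial (by linarith)
  rw [this] at t1
  have : 0 < α / 2 * t := by positivity
  linarith

end BN2

section BN3
variable {X : Type*} [NormedAddCommGroup X] [NormedSpace ℝ X]

theorem bn_isOpen_neg {K : Type*} [TopologicalSpace K] [CompactSpace K] (J : X → ℝ)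
    (hJ : Continuous J) : IsOpen {f : C(K, X) | ∀ ξ, J (f ξ) < 0} := by
  have := ContinuousMap.isOpen_setOfPred_mapsTo (X := K) (Y := X) isCompact_univ
    (isOpen_lt hJ continuous_const : IsOpen {x | J x < 0})
  simpa [Set.MapsTo] using this

theorem bn_isClosed_le {K : Type*} [TopologicalSpace K] [CompactSpace K] (J : X → ℝ)
    (hJ : Continuous J) (M : ℝ) : IsClosed {f : C(K, X) | ∀ ξ, J (f ξ) ≤ M} := by
  have : {f : C(K, X) | ∀ ξ, J (f ξ) ≤ M} = ⋂ ξ, {f : C(K, X) | J (f ξ) ≤ M} := by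
    ext; simp
  rw [this]
  exact isClosed_iInter fun ξ =>
    isClosed_le (hJ.comp (by fun_prop : Continuous fun f : C(_, X) => f ξ)) continuous_const

/-- nearby points of an open set of a normed space are joined inside it -/
theorem bn_joined_near {Y : Type*} [NormedAddCommGroup Y] [NormedSpace ℝ Y] (U : Set Y)
    (hU : IsOpen U) (x : Y) (hx : x ∈ U) : ∀ᶠ y in 𝓝 x, JoinedIn U x y := by
  obtain ⟨ε, hε, hb⟩ := Metric.isOpen_iff.mp hU x hx
  filter_upwards [Metric.ball_mem_nhds x hε] with y hy
  have hc : IsPathConnected (Metric.ball x ε) :=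
    (convex_ball x ε).isPathConnected ⟨x, Metric.mem_ball_self hε⟩
  exact (hc.joinedIn x (Metric.mem_ball_self hε) y hy).mono hb

theorem bn_contract [CompleteSpace X] {K : Type*} [TopologicalSpace K] [CompactSpace K]
    [T2Space K] [Nonempty K]
    (J : X → ℝ) (hJ : ContDiff ℝ 1 J)
    (hPS : ∀ u : ℕ → X, (∃ M : ℝ, ∀ n, |J (u n)| ≤ M) →
      Tendsto (fun n => ‖fderiv ℝ J (u n)‖) atTop (nhds 0) →
      ∃ (v : X) (φ : ℕ → ℕ), StrictMono φ ∧ Tendsto (u ∘ φ) atTop (nhds v))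
    (u0 : X) (hm : ∀ x, J u0 ≤ J x) (h0 : J u0 < 0) (hJ0 : J 0 = 0)
    (hcr : ∀ u, fderiv ℝ J u = 0 → u = 0 ∨ u = u0)
    (ι : C(K, X)) (hι : ∀ ξ, J (ι ξ) ≤ 0) (hι0 : ∀ ξ, ι ξ ≠ 0) :
    ∃ γ : Path ι (ContinuousMap.const K u0), ∀ s, s ≠ 0 → ∀ ξ, J (γ s ξ) < 0 := by
  have hJc := hJ.continuous
  have hcr' : ∀ u, J u < 0 → fderiv ℝ J u = 0 → u = u0 := by
    intro u hu hc
    rcases hcr u hc with h | h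
    · rw [h, hJ0] at hu; exact absurd hu (lt_irrefl _)
    · exact h
  let U : Set C(K, X) := {f | ∀ ξ, J (f ξ) < 0}
  have hU : IsOpen U := bn_isOpen_neg J hJc
  obtain ⟨w, hw1, -, -, hw⟩ := bn_select J hJ ι ∅ ∅ {ξ | J (ι ξ) = 0} isClosed_empty
    (isClosed_eq (by fun_prop) continuous_const) isClosed_empty 0 le_rfl (by simp) (by
      intro ξ hξ
      refine ⟨by simp, fun hc => ?_⟩
      rcases hcr _ hc with h | h
      · exact hι0 ξ h
      · have hξ' : J (ι ξ) = 0 := hξ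
        rw [h] at hξ'; linarith)
  have e1 := bn_descend J hJ (fun _ => 0) 0 continuous_const (by simp) le_rfl ι w hw1 0 0
    (by simpa using hι) (fun ξ h => hw ξ (by simpa using h))
  obtain ⟨t0, ht0, hsub⟩ := mem_nhdsGT_iff_exists_Ioc_subset.mp e1
  have ht0 : 0 < t0 := ht0
  have hneg : ∀ t, 0 < t → t ≤ t0 → ι - t • w ∈ U := by
    intro t h1 h2 ξ
    have := hsub ⟨h1, h2⟩ ξ
    simpa using this
  set p1 : C(K, X) := ι - t0 • w with hp1
  have hp1U : p1 ∈ U := hneg t0 ht0 le_rfl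
  let γ1 : Path ι p1 :=
    { toFun := fun s => ι - ((s : ℝ) * t0) • w
      continuous_toFun := by fun_prop
      source' := by simp
      target' := by simp [hp1] }
  have hγ1 : ∀ s, s ≠ 0 → γ1 s ∈ U := by
    intro s hs
    have hs0 : 0 < (s : ℝ) := unitInterval.pos_iff_ne_zero.mpr hs
    exact hneg _ (by positivity) (mul_le_of_le_one_left ht0.le s.2.2)
  -- the maximum of J along p1
  obtain ⟨ξm, -, hξm⟩ := (isCompact_univ (X := K)).exists_isMaxOn Set.univ_nonempty
    (hJc.comp p1.continuous).continuousOn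
  have hmax : ∀ ξ, J (p1 ξ) ≤ J (p1 ξm) := fun ξ => hξm (Set.mem_univ ξ)
  set M0 := J (p1 ξm) with hM0
  have hM0n : M0 < 0 := hp1U ξm
  -- a ball around the minimum
  obtain ⟨δ, hδ, hball⟩ := Metric.isOpen_iff.mp
    (isOpen_lt hJc continuous_const : IsOpen {x | J x < 0}) u0 h0
  obtain ⟨η, hη, hloc⟩ := bn_loc J hJ hPS u0 hm h0 hcr' δ hδ
  have key : ∃ f, JoinedIn U p1 f ∧ ∀ ξ, J (f ξ) < J u0 + η := by
    by_cases hsmall : M0 < J u0 + η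
    · exact ⟨p1, JoinedIn.refl hp1U, fun ξ => (hmax ξ).trans_lt hsmall⟩
    push Not at hsmall
    obtain ⟨α, hα, hreg⟩ := bn_reg J hJ hPS {u | J u0 + η ≤ J u ∧ J u ≤ M0}
      ((isClosed_le continuous_const hJc).inter (isClosed_le hJc continuous_const))
      (-J u0) (fun u hu => by
        have h1 := hm u
        have h2 := hu.2
        rw [abs_le]
        constructor <;> linarith)
      (fun u hu hc => by
        have := hcr' u (by have := hu.2; linarith) hc
        have h2 := hu.1
        rw [this] at h2
        linarith)
    have hAc : IsClosed ({f | JoinedIn U p1 f} ∩ {f : C(K, X) | ∀ ξ, J (f ξ) ≤ M0}) := by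
      refine isClosed_of_closure_subset fun f hf => ?_
      have hfM : ∀ ξ, J (f ξ) ≤ M0 :=
        closure_minimal Set.inter_subset_right (bn_isClosed_le J hJc M0) hf
      have hfU : f ∈ U := fun ξ => (hfM ξ).trans_lt hM0n
      refine ⟨?_, hfM⟩
      have hnear := bn_joined_near U hU f hfU
      obtain ⟨g, hg1, hg2⟩ := (mem_closure_iff_frequently.mp hf).and_eventually hnear |>.exists
      exact hg1.1.trans hg2.symm
    obtain ⟨f, hfA, -, hf⟩ := bn_deform J hJ (J u0) hm (fun _ => 0) 0 continuous_const (by simp)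
      le_rfl (by simp) ∅ isClosed_empty {f | JoinedIn U p1 f} M0 (J u0 + η) α hα hAc
      (by
        intro f hf _ w _
        have hnear := bn_joined_near U hU f hf.target_mem
        have ht : Tendsto (fun t : ℝ => f - t • w) (𝓝[>] 0) (𝓝 f) := by
          have : Continuous (fun t : ℝ => f - t • w) := by fun_prop
          have h := this.tendsto 0
          simp only [zero_smul, sub_zero] at h
          exact h.mono_left nhdsWithin_le_nhds
        filter_upwards [ht.eventually hnear] with t h
        exact JoinedIn.trans hf h)
      (by
        intro f _ hfM ξ hξ
        refine ⟨by simp, fun hc => ?_⟩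
        have := hreg (f ξ) ⟨by rw [hξ]; exact hsmall, hfM ξ⟩
        rw [hc, norm_zero] at this
        linarith)
      (by
        intro f _ hfM ξ hξ
        exact ⟨by simp, hreg _ ⟨by simpa using hξ, hfM ξ⟩⟩)
      p1 (JoinedIn.refl hp1U) hmax
    exact ⟨f, hfA, fun ξ => by simpa using hf ξ⟩
  obtain ⟨f, hfj, hf⟩ := key
  have hfb : ∀ ξ, f ξ ∈ Metric.ball u0 δ := fun ξ => by
    rw [mem_ball_iff_norm]; exact hloc _ (hf ξ).le
  have hj2 : JoinedIn U f (ContinuousMap.const K u0) := by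
    refine JoinedIn.of_segment_subset ?_
    rintro g ⟨a, b, ha, hb, hab, rfl⟩ ξ
    refine hball ?_
    exact (convex_ball u0 δ) (hfb ξ) (Metric.mem_ball_self hδ) ha hb hab
  have hj := hfj.trans hj2
  refine ⟨γ1.trans hj.somePath, fun s hs ξ => ?_⟩
  have hs0 : 0 < (s : ℝ) := unitInterval.pos_iff_ne_zero.mpr hs
  rw [Path.trans_apply]
  split_ifs with h
  · refine hγ1 _ (fun h0 => ?_) ξ
    have := congrArg Subtype.val h0
    simp at this
    exact hs this
  · exact hj.somePath_mem _ ξ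

end BN3

section BN4

abbrev BnK (V : Type*) [NormedAddCommGroup V] (ρ : ℝ) : Type _ :=
  ↥(Metric.closedBall (0 : V) ρ ×ˢ Set.Icc (0 : ℝ) 1)

theorem bn_link_core {X V : Type*} [NormedAddCommGroup X] [NormedSpace ℝ X]
    [NormedAddCommGroup V] [NormedSpace ℝ V] [FiniteDimensional ℝ V] (ρ : ℝ) (hρ : 0 < ρ)
    (P : X →L[ℝ] V) (r : ℝ) (f : BnK V ρ → X) (hf : Continuous f)
    (hb : ∀ ξ : BnK V ρ, ‖ξ.1.1‖ = ρ → P (f ξ) = ξ.1.1)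
    (h0 : ∀ ξ : BnK V ρ, ξ.1.2 = 0 → P (f ξ) = 0 → ‖f ξ‖ ≤ r)
    (h1 : ∀ ξ : BnK V ρ, ξ.1.2 = 1 → P (f ξ) = 0 → r ≤ ‖f ξ‖) :
    ∃ ξ, P (f ξ) = 0 ∧ ‖f ξ‖ = r := by
  let π : V → V := fun x => (ρ / max ρ ‖x‖) • x
  have hpos : ∀ x : V, 0 < max ρ ‖x‖ := fun x => lt_max_of_lt_left hρ
  have hπc : Continuous π := by
    refine Continuous.smul (Continuous.div (by fun_prop) (by fun_prop) fun x => (hpos x).ne') ?_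
    fun_prop
  have hπn : ∀ x, ‖π x‖ = ρ / max ρ ‖x‖ * ‖x‖ := fun x => by
    rw [norm_smul, Real.norm_eq_abs, abs_of_pos (div_pos hρ (hpos x))]
  have hπle : ∀ x, ‖π x‖ ≤ ρ := fun x => by
    rw [hπn, div_mul_eq_mul_div, div_le_iff₀ (hpos x)]
    exact mul_le_mul_of_nonneg_left (le_max_right _ _) hρ.le
  have hπid : ∀ x, ‖x‖ ≤ ρ → π x = x := fun x hx => by
    simp only [π]; rw [max_eq_left hx, div_self hρ.ne', one_smul]
  have hπout : ∀ x, ρ < ‖x‖ → ‖π x‖ = ρ := fun x hx => by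
    rw [hπn, max_eq_right hx.le, div_mul_cancel₀ _ (by linarith)]
  let c : ℝ → ℝ := fun t => max 0 (min 1 t)
  have hcc : Continuous c := by fun_prop
  have hc0 : ∀ t, 0 ≤ c t := fun t => le_max_left _ _
  have hc1 : ∀ t, c t ≤ 1 := fun t => max_le zero_le_one (min_le_left _ _)
  have hcid : ∀ t, 0 ≤ t → t ≤ 1 → c t = t := fun t a b => by
    simp only [c]; rw [min_eq_right b, max_eq_right a]
  let q : V × ℝ → BnK V ρ := fun p =>
    ⟨(π p.1, c p.2), by
      refine ⟨?_, hc0 _, hc1 _⟩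
      simpa using hπle p.1⟩
  have hq : Continuous q := by fun_prop
  let g : V × ℝ → V × ℝ := fun p =>
    (π (π p.1 - P (f (q p))), c (c p.2 - (‖f (q p)‖ - r)))
  have hg : Continuous g := by fun_prop
  obtain ⟨⟨x, t⟩, hfix⟩ := bn_brouwer g hg (max ρ 1) (fun p => by
    rw [Prod.norm_def]
    refine max_le_max (hπle _) ?_
    rw [Real.norm_eq_abs, abs_of_nonneg (hc0 _)]
    exact hc1 _)
  have hx : π (π x - P (f (q (x, t)))) = x := congrArg Prod.fst hfix
  have ht : c (c t - (‖f (q (x, t))‖ - r)) = t := congrArg Prod.snd hfix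
  have hxρ : ‖x‖ ≤ ρ := by rw [← hx]; exact hπle _
  have ht0 : 0 ≤ t := by rw [← ht]; exact hc0 _
  have ht1 : t ≤ 1 := by rw [← ht]; exact hc1 _
  have q1 : (q (x, t)).1.1 = x := hπid x hxρ
  have q2 : (q (x, t)).1.2 = t := hcid t ht0 ht1
  set ξ := q (x, t) with hξ
  rw [hπid x hxρ] at hx
  rw [hcid t ht0 ht1] at ht
  have hy : P (f ξ) = 0 := by
    by_cases hle : ‖x - P (f ξ)‖ ≤ ρ
    · rw [hπid _ hle] at hx
      simpa using hx
    · exfalso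
      push Not at hle
      have h3 := hπout _ hle
      rw [hx] at h3
      have h4 := hb ξ (by rw [q1]; exact h3)
      rw [h4, q1, sub_self, norm_zero] at hle
      linarith
  refine ⟨ξ, hy, ?_⟩
  simp only [c] at ht
  rcases eq_or_lt_of_le ht0 with e | e
  · have := h0 ξ (by rw [q2, ← e]) hy
    refine le_antisymm this ?_
    by_contra! hlt
    have h5 : 0 < max 0 (min 1 (t - (‖f ξ‖ - r))) := lt_max_of_lt_right (lt_min one_pos (by linarith))
    linarith
  rcases eq_or_lt_of_le ht1 with e' | e'
  · have := h1 ξ (by rw [q2, e']) hy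
    refine le_antisymm ?_ this
    by_contra! hlt
    have h5 : max 0 (min 1 (t - (‖f ξ‖ - r))) < 1 := max_lt one_pos (min_lt_of_right_lt (by linarith))
    linarith
  · rcases max_cases 0 (min 1 (t - (‖f ξ‖ - r))) with h | h <;>
      rcases min_cases 1 (t - (‖f ξ‖ - r)) with h' | h' <;> linarith

theorem bn_cone {X V : Type*} [NormedAddCommGroup X] [NormedSpace ℝ X] [CompleteSpace X]
    [NormedAddCommGroup V] [NormedSpace ℝ V] [FiniteDimensional ℝ V] (ρ : ℝ) (hρ : 0 < ρ)
    (j : V →L[ℝ] X) (hj : ∀ x, j x = 0 → x = 0)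
    (J : X → ℝ) (hJ : ContDiff ℝ 1 J)
    (hPS : ∀ u : ℕ → X, (∃ M : ℝ, ∀ n, |J (u n)| ≤ M) →
      Tendsto (fun n => ‖fderiv ℝ J (u n)‖) atTop (nhds 0) →
      ∃ (v : X) (φ : ℕ → ℕ), StrictMono φ ∧ Tendsto (u ∘ φ) atTop (nhds v))
    (u0 : X) (hm : ∀ x, J u0 ≤ J x) (h0 : J u0 < 0) (hJ0 : J 0 = 0)
    (hcr : ∀ u, fderiv ℝ J u = 0 → u = 0 ∨ u = u0)
    (hjJ : ∀ x, ‖x‖ ≤ ρ → J (j x) ≤ 0) :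
    ∃ h : V → X, Continuous h ∧ (∀ x, ‖x‖ = ρ → h x = j x) ∧ ∀ x, ‖x‖ < ρ → J (h x) < 0 := by
  by_cases hne : Nonempty (Metric.sphere (0 : V) ρ)
  swap
  · refine ⟨fun _ => u0, continuous_const, fun x hx => ?_, fun _ _ => h0⟩
    exact absurd ⟨⟨x, by simp [hx]⟩⟩ hne
  have : ProperSpace V := FiniteDimensional.proper ℝ V
  have : CompactSpace (Metric.sphere (0 : V) ρ) :=
    isCompact_iff_compactSpace.mp (isCompact_sphere 0 ρ)
  let ι : C(Metric.sphere (0 : V) ρ, X) := ⟨fun x => j x.1, by fun_prop⟩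
  have hnorm : ∀ x : Metric.sphere (0 : V) ρ, ‖x.1‖ = ρ := fun x => by simpa using x.2
  obtain ⟨γ, hγ⟩ := bn_contract J hJ hPS u0 hm h0 hJ0 hcr ι (fun x => hjJ _ (hnorm x).le)
    (fun x hx => by
      have h1 := hj _ hx
      have h2 := hnorm x
      rw [h1, norm_zero] at h2
      exact hρ.ne h2)
  have hpr : ∀ x : V, x ≠ 0 → (ρ / ‖x‖) • x ∈ Metric.sphere (0 : V) ρ := fun x hx => by
    have : 0 < ‖x‖ := norm_pos_iff.mpr hx
    rw [mem_sphere_zero_iff_norm, norm_smul, Real.norm_eq_abs, abs_of_pos (by positivity),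
      div_mul_cancel₀ _ this.ne']
  classical
  let h : V → X := fun x => if hx : x = 0 then u0 else
    γ.extend (1 - ‖x‖ / ρ) ⟨(ρ / ‖x‖) • x, hpr x hx⟩
  have hh0 : h 0 = u0 := by simp [h]
  have hh : ∀ x (hx : x ≠ 0), h x = γ.extend (1 - ‖x‖ / ρ) ⟨(ρ / ‖x‖) • x, hpr x hx⟩ :=
    fun x hx => by simp only [h, dif_neg hx]
  refine ⟨h, ?_, ?_, ?_⟩
  · rw [continuous_iff_continuousAt]
    intro x
    by_cases hx : x = 0
    · subst hx
      rw [Metric.continuousAt_iff']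
      intro ε hε
      have hc : Continuous (fun x : V => γ.extend (1 - ‖x‖ / ρ)) := by
        have := γ.continuous_extend
        fun_prop
      have h1 := Metric.tendsto_nhds.mp (hc.tendsto 0) ε hε
      filter_upwards [h1] with y hy
      rw [hh0]
      by_cases hy0 : y = 0
      · rw [hy0, hh0, dist_self]; exact hε
      · rw [hh y hy0]
        refine lt_of_le_of_lt ?_ hy
        have := ContinuousMap.dist_apply_le_dist (f := γ.extend (1 - ‖y‖ / ρ))
          (g := γ.extend (1 - ‖(0 : V)‖ / ρ)) ⟨(ρ / ‖y‖) • y, hpr y hy0⟩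
        simpa using this
    · have hopen : IsOpen ({0}ᶜ : Set V) := isOpen_compl_singleton
      refine ContinuousOn.continuousAt ?_ (hopen.mem_nhds hx)
      rw [continuousOn_iff_continuous_domRestrict]
      have he : Set.domRestrict ({0}ᶜ : Set V) h = fun y : ({0}ᶜ : Set V) =>
          γ.extend (1 - ‖y.1‖ / ρ) ⟨(ρ / ‖y.1‖) • y.1, hpr y.1 y.2⟩ := by
        ext y
        exact hh y.1 y.2
      rw [he]
      have hc := γ.continuous_extend
      have hd : Continuous (fun y : ({0}ᶜ : Set V) => ρ / ‖y.1‖) :=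
        Continuous.div (by fun_prop) (by fun_prop) (fun y => norm_ne_zero_iff.mpr y.2)
      have hd2 : Continuous (fun y : ({0}ᶜ : Set V) =>
          (⟨(ρ / ‖y.1‖) • y.1, hpr y.1 y.2⟩ : Metric.sphere (0 : V) ρ)) := by
        refine Continuous.subtype_mk ?_ _
        fun_prop
      have hd3 : Continuous (fun y : ({0}ᶜ : Set V) => γ.extend (1 - ‖y.1‖ / ρ)) := by fun_prop
      exact hd3.eval hd2
  · intro x hx
    have hx0 : x ≠ 0 := fun h => by rw [h, norm_zero] at hx; exact hρ.ne hx
    rw [hh x hx0]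
    simp [hx, ι, div_self hρ.ne']
  · intro x hx
    by_cases hx0 : x = 0
    · rw [hx0, hh0]; exact h0
    · rw [hh x hx0]
      have hm1 : 1 - ‖x‖ / ρ ∈ Set.Icc (0 : ℝ) 1 := by
        have : ‖x‖ / ρ < 1 := (div_lt_one hρ).mpr hx
        have : 0 ≤ ‖x‖ / ρ := by positivity
        constructor <;> linarith
      rw [Path.extend_apply _ hm1]
      refine hγ _ (fun hz => ?_) _
      have hz := congrArg Subtype.val hz
      have : ‖x‖ / ρ < 1 := (div_lt_one hρ).mpr hx
      have hz' : 1 - ‖x‖ / ρ = 0 := hz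
      linarith

end BN4

/-- Brézis–Nirenberg linking theorem: if `X = X₁ ⊕ X₂` with `dim X₂ < ∞`, and
`J ∈ C¹(X,ℝ)` with `J(0) = 0` satisfies the Palais–Smale condition, is bounded below
with `inf J < 0`, and for some `ρ > 0` one has `J ≥ 0` on `X₁ ∩ B̄(0,ρ)` and `J ≤ 0` on
`X₂ ∩ B̄(0,ρ)`, then `J` has at least two nontrivial critical points. -/
theorem brezis_nirenberg_linking
    (X : Type*) [NormedAddCommGroup X] [NormedSpace ℝ X] [CompleteSpace X]
    (X₁ X₂ : Submodule ℝ X) (hcompl : IsCompl X₁ X₂)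
    (hclosed : IsClosed (X₁ : Set X)) [FiniteDimensional ℝ X₂]
    (J : X → ℝ) (hJ : ContDiff ℝ 1 J) (hJ0 : J 0 = 0)
    (hPS : ∀ u : ℕ → X, (∃ M : ℝ, ∀ n, |J (u n)| ≤ M) →
      Tendsto (fun n => ‖fderiv ℝ J (u n)‖) atTop (nhds 0) →
      ∃ (v : X) (φ : ℕ → ℕ), StrictMono φ ∧ Tendsto (u ∘ φ) atTop (nhds v))
    (hbelow : BddBelow (Set.range J)) (hneg : ∃ w : X, J w < 0)
    (ρ : ℝ) (hρ : 0 < ρ)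
    (hX₁ : ∀ u ∈ X₁, ‖u‖ ≤ ρ → 0 ≤ J u)
    (hX₂ : ∀ u ∈ X₂, ‖u‖ ≤ ρ → J u ≤ 0) :
    ∃ u v : X, u ≠ 0 ∧ v ≠ 0 ∧ u ≠ v ∧ fderiv ℝ J u = 0 ∧ fderiv ℝ J v = 0 := by
  by_contra hcon
  have hJc := hJ.continuous
  obtain ⟨m, hm'⟩ := hbelow
  have hm : ∀ x, m ≤ J x := fun x => hm' ⟨x, rfl⟩
  obtain ⟨w, hw⟩ := hneg
  obtain ⟨u0, hu0w, hu0c⟩ := bn_exists_crit J hJ hPS m hm w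
  have hJu0 : J u0 < 0 := hu0w.trans_lt hw
  have hu00 : u0 ≠ 0 := fun h => by rw [h, hJ0] at hJu0; exact lt_irrefl _ hJu0
  have hcr : ∀ u, fderiv ℝ J u = 0 → u = 0 ∨ u = u0 := by
    intro u hu
    by_contra! hne
    exact hcon ⟨u, u0, hne.1, hu00, hne.2, hu, hu0c⟩
  have hmin : ∀ x, J u0 ≤ J x := by
    intro x
    by_contra! hx
    obtain ⟨y, hy, hyc⟩ := bn_exists_crit J hJ hPS m hm x
    rcases hcr y hyc with h | h
    · rw [h, hJ0] at hy; linarith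
    · rw [h] at hy; linarith
  have hcrJ : ∀ u, 0 < J u → fderiv ℝ J u ≠ 0 := by
    intro u hu hc
    rcases hcr u hc with h | h
    · rw [h, hJ0] at hu; exact lt_irrefl _ hu
    · rw [h] at hu; linarith
  have hX₂closed : IsClosed (X₂ : Set X) := X₂.closed_of_finiteDimensional
  have htc := Submodule.IsCompl.isTopCompl_of_isClosed hcompl.symm hX₂closed hclosed
  let P : X →L[ℝ] X₂ := X₂.projectionOntoL X₁ htc
  have hPx : ∀ x : X₂, P x = x := fun x => Submodule.projectionOntoL_apply_left htc x
  have hP0 : ∀ x : X, P x = 0 ↔ x ∈ X₁ := fun x => Submodule.projectionOntoL_apply_eq_zero_iff htc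
  obtain ⟨h, hhc, hhρ, hhneg⟩ := bn_cone (V := X₂) ρ hρ X₂.subtypeL
    (fun x hx => by simpa using hx) J hJ hPS u0 hmin hJu0 hJ0 hcr
    (fun x hx => hX₂ x x.2 hx)
  have hhρ : ∀ x : X₂, ‖x‖ = ρ → h x = x := hhρ
  have : ProperSpace X₂ := FiniteDimensional.proper ℝ X₂
  have : CompactSpace (BnK X₂ ρ) :=
    isCompact_iff_compactSpace.mp ((isCompact_closedBall 0 ρ).prod isCompact_Icc)
  have : Nonempty (BnK X₂ ρ) := ⟨⟨(0, 0), by simp [hρ.le]⟩⟩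
  have hKn : ∀ ξ : BnK X₂ ρ, ‖ξ.1.1‖ ≤ ρ := fun ξ => by simpa using ξ.2.1
  let f0 : C(BnK X₂ ρ, X) :=
    ⟨fun ξ => (1 - ξ.1.2) • (ξ.1.1 : X) + ξ.1.2 • h ξ.1.1, by fun_prop⟩
  have f0a : ∀ ξ : BnK X₂ ρ, ‖ξ.1.1‖ = ρ → f0 ξ = ξ.1.1 := fun ξ hξ => by
    simp only [f0, ContinuousMap.coe_mk]
    rw [hhρ _ hξ, ← add_smul]; simp
  have f0b : ∀ ξ : BnK X₂ ρ, ξ.1.2 = 0 → f0 ξ = ξ.1.1 := fun ξ hξ => by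
    simp [f0, hξ]
  have f0c : ∀ ξ : BnK X₂ ρ, ξ.1.2 = 1 → f0 ξ = h ξ.1.1 := fun ξ hξ => by
    simp [f0, hξ]
  let K0 : Set (BnK X₂ ρ) := {ξ | ‖ξ.1.1‖ = ρ} ∪ ({ξ | ξ.1.2 = 0} ∪ {ξ | ξ.1.2 = 1})
  have hK0 : IsClosed K0 :=
    (isClosed_eq (by fun_prop) continuous_const).union
      ((isClosed_eq (by fun_prop) continuous_const).union
        (isClosed_eq (by fun_prop) continuous_const))
  have hf0K0 : ∀ ξ ∈ K0, J (f0 ξ) < 0 ∨ (f0 ξ ∈ X₂ ∧ J (f0 ξ) ≤ 0) := by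
    rintro ξ (hξ | hξ | hξ)
    · right; rw [f0a ξ hξ]; exact ⟨ξ.1.1.2, hX₂ _ ξ.1.1.2 (hKn ξ)⟩
    · right; rw [f0b ξ hξ]; exact ⟨ξ.1.1.2, hX₂ _ ξ.1.1.2 (hKn ξ)⟩
    · rcases (hKn ξ).lt_or_eq with hlt | heq
      · left; rw [f0c ξ hξ]; exact hhneg _ hlt
      · right; rw [f0a ξ heq]; exact ⟨ξ.1.1.2, hX₂ _ ξ.1.1.2 (hKn ξ)⟩
  have hf0K0' : ∀ ξ ∈ K0, J (f0 ξ) ≤ 0 := fun ξ hξ => by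
    rcases hf0K0 ξ hξ with h | h
    · exact h.le
    · exact h.2
  let Γ : Set C(BnK X₂ ρ, X) := {f | ∀ ξ ∈ K0, f ξ = f0 ξ}
  have hΓc : IsClosed Γ := by
    have : Γ = ⋂ ξ ∈ K0, {f | f ξ = f0 ξ} := by ext; simp [Γ]
    rw [this]
    exact isClosed_biInter fun ξ _ =>
      isClosed_eq (by fun_prop : Continuous fun f : C(BnK X₂ ρ, X) => f ξ) continuous_const
  have hΓs : ∀ f ∈ Γ, ∀ w : C(BnK X₂ ρ, X), (∀ ξ ∈ K0, w ξ = 0) →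
      ∀ᶠ t : ℝ in 𝓝[>] 0, f - t • w ∈ Γ := by
    intro f hf w hw
    refine Eventually.of_forall fun t ξ hξ => ?_
    simp [hw ξ hξ, hf ξ hξ]
  have hu0n : 0 < ‖u0‖ := norm_pos_iff.mpr hu00
  set r := min ρ (‖u0‖ / 2) with hr
  have hr0 : 0 < r := lt_min hρ (by positivity)
  have hrρ : r ≤ ρ := min_le_left _ _
  have hru : r ≤ ‖u0‖ / 2 := min_le_right _ _
  have hlink : ∀ f ∈ Γ, ∃ ξ, f ξ ∈ X₁ ∧ ‖f ξ‖ = r := by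
    intro f hf
    have hfa : ∀ ξ : BnK X₂ ρ, ‖ξ.1.1‖ = ρ → f ξ = ξ.1.1 := fun ξ hξ => by
      rw [hf ξ (Or.inl hξ), f0a ξ hξ]
    have hfb : ∀ ξ : BnK X₂ ρ, ξ.1.2 = 0 → f ξ = ξ.1.1 := fun ξ hξ => by
      rw [hf ξ (Or.inr (Or.inl hξ)), f0b ξ hξ]
    have hfc : ∀ ξ : BnK X₂ ρ, ξ.1.2 = 1 → f ξ = h ξ.1.1 := fun ξ hξ => by
      rw [hf ξ (Or.inr (Or.inr hξ)), f0c ξ hξ]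
    obtain ⟨ξ, h1, h2⟩ := bn_link_core ρ hρ P r f f.continuous
      (fun ξ hξ => by rw [hfa ξ hξ, hPx])
      (fun ξ hξ hp => by
        rw [hfb ξ hξ] at hp ⊢
        rw [hPx] at hp
        rw [hp]; simpa using hr0.le)
      (fun ξ hξ hp => by
        by_contra! hlt
        have h1 := hX₁ _ ((hP0 _).mp hp) (hlt.le.trans hrρ)
        rcases (hKn ξ).lt_or_eq with hl | he
        · rw [hfc ξ hξ] at h1
          have := hhneg _ hl
          linarith
        · rw [hfa ξ he, hPx] at hp
          rw [hp, norm_zero] at he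
          exact hρ.ne he)
    exact ⟨ξ, (hP0 _).mp h1, h2⟩
  -- constants
  set R := r / 2 with hR
  have hR0 : 0 < R := by positivity
  obtain ⟨α1, hα1, hreg1⟩ := bn_reg J hJ hPS {u | (R ≤ ‖u‖ ∧ ‖u‖ ≤ r + R) ∧ |J u| ≤ 1}
    (((isClosed_le continuous_const continuous_norm).inter
      (isClosed_le continuous_norm continuous_const)).inter
      (isClosed_le hJc.abs continuous_const)) 1 (fun u hu => hu.2)
    (fun u hu hc => by
      obtain ⟨⟨h1, h2⟩, -⟩ := hu
      rcases hcr u hc with h | h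
      · rw [h, norm_zero] at h1; linarith
      · rw [h] at h2; linarith)
  set a := α1 / 2 with ha
  have ha0 : 0 < a := by positivity
  set ε := min 1 (a * R) / 2 with hε
  have hε0 : 0 < ε := by
    have : 0 < min 1 (a * R) := lt_min one_pos (by positivity)
    positivity
  have hε1 : ε ≤ 1 := by
    have : min 1 (a * R) ≤ 1 := min_le_left _ _
    linarith
  have hε2 : ε ≤ a * R / 2 := by
    have : min 1 (a * R) ≤ a * R := min_le_right _ _
    linarith
  have hnotK0 : ∀ f ∈ Γ, ∀ ξ, 0 < J (f ξ) → ξ ∉ K0 := by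
    intro f hf ξ hp hk
    have := hf0K0' ξ hk
    rw [hf ξ hk] at hp
    linarith
  -- step A
  obtain ⟨f1, hf1, hf1ε⟩ : ∃ f ∈ Γ, ∀ ξ, J (f ξ) < ε := by
    obtain ⟨ξm, -, hξm⟩ := (isCompact_univ (X := BnK X₂ ρ)).exists_isMaxOn Set.univ_nonempty
      (hJc.comp f0.continuous).continuousOn
    have hmax : ∀ ξ, J (f0 ξ) ≤ J (f0 ξm) := fun ξ => hξm (Set.mem_univ ξ)
    set M0 := max ε (J (f0 ξm)) with hM0
    have hM0ε : ε ≤ M0 := le_max_left _ _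
    obtain ⟨α2, hα2, hreg2⟩ := bn_reg J hJ hPS {u | ε ≤ J u ∧ J u ≤ M0}
      ((isClosed_le continuous_const hJc).inter (isClosed_le hJc continuous_const)) M0
      (fun u hu => by
        have h1 := hu.1
        rw [abs_of_pos (by linarith)]; exact hu.2)
      (fun u hu => hcrJ u (lt_of_lt_of_le hε0 hu.1))
    obtain ⟨f, hfΓ, -, hf⟩ := bn_deform J hJ m hm (fun _ => 0) 0 continuous_const (by simp)
      le_rfl (by simp) K0 hK0 Γ M0 ε α2 hα2 (hΓc.inter (bn_isClosed_le J hJc M0))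
      (fun f hf _ w hw => hΓs f hf w hw)
      (fun f hf _ ξ hξ => by
        have hp : 0 < J (f ξ) := by rw [hξ]; linarith
        exact ⟨hnotK0 f hf ξ hp, hcrJ _ hp⟩)
      (fun f hf hfM ξ hξ => by
        have hξ' : ε ≤ J (f ξ) := by simpa using hξ
        exact ⟨hnotK0 f hf ξ (hε0.trans_le hξ'), hreg2 _ ⟨hξ', hfM ξ⟩⟩)
      f0 (fun ξ _ => rfl) (fun ξ => (hmax ξ).trans (le_max_right _ _))
    exact ⟨f, hfΓ, fun ξ => by simpa using hf ξ⟩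
  -- step B
  let S1 : Set X := {u | u ∈ X₁ ∧ ‖u‖ = r}
  have hS1c : IsClosed S1 := IsClosed.inter hclosed (isClosed_eq continuous_norm continuous_const)
  have hS1n : S1.Nonempty := by
    obtain ⟨ξ, h1, h2⟩ := hlink f1 hf1
    exact ⟨f1 ξ, h1, h2⟩
  let θ : X → ℝ := fun u => a * max 0 (R - Metric.infDist u S1)
  have hd0 : ∀ u, 0 ≤ Metric.infDist u S1 := fun u => Metric.infDist_nonneg
  have hθc : Continuous θ := by
    have := Metric.continuous_infDist_pt S1
    fun_prop
  have hθle : ∀ u, θ u ≤ a * R := fun u =>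
    mul_le_mul_of_nonneg_left (max_le hR0.le (by linarith [hd0 u])) ha0.le
  have hθL : ∀ x y, θ x - θ y ≤ a * ‖x - y‖ := by
    intro x y
    have h1 : Metric.infDist y S1 ≤ Metric.infDist x S1 + dist y x :=
      Metric.infDist_le_infDist_add_dist
    rw [dist_comm, dist_eq_norm] at h1
    have h2 : max 0 (R - Metric.infDist x S1) ≤ max 0 (R - Metric.infDist y S1) + ‖x - y‖ := by
      refine max_le (add_nonneg (le_max_left _ _) (norm_nonneg _)) ?_
      have := le_max_right 0 (R - Metric.infDist y S1)
      linarith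
    have h3 := mul_le_mul_of_nonneg_left h2 ha0.le
    simp only [θ]
    linarith
  obtain ⟨f, hfΓ, -, hf⟩ := bn_deform J hJ m hm θ a hθc hθL ha0.le
    (fun u => mul_nonneg ha0.le (le_max_left _ _)) K0 hK0 Γ ε (a * R) α1 (by linarith)
    (hΓc.inter (bn_isClosed_le J hJc ε)) (fun f hf _ w hw => hΓs f hf w hw)
    (fun f hf _ ξ hξ => by
      have hp : 0 < J (f ξ) := by rw [hξ]; exact hε0
      exact ⟨hnotK0 f hf ξ hp, hcrJ _ hp⟩)
    (fun f hf hfM ξ hξ => by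
      have hJM := hfM ξ
      have hθl := hθle (f ξ)
      constructor
      · intro hk
        have hle := hf0K0' ξ hk
        rw [← hf ξ hk] at hle
        have hθe : a * R ≤ θ (f ξ) := by linarith
        have hmx : R ≤ max 0 (R - Metric.infDist (f ξ) S1) := le_of_mul_le_mul_left hθe ha0
        have hz : Metric.infDist (f ξ) S1 = 0 := by
          rcases le_max_iff.mp hmx with h | h
          · linarith
          · linarith [hd0 (f ξ)]
        have hmem : f ξ ∈ S1 := (hS1c.mem_iff_infDist_zero hS1n).mpr hz
        rcases hf0K0 ξ hk with h | h
        · rw [← hf ξ hk] at h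
          linarith
        · rw [← hf ξ hk] at h
          have hb : f ξ ∈ X₁ ⊓ X₂ := ⟨hmem.1, h.1⟩
          rw [hcompl.inf_eq_bot, Submodule.mem_bot] at hb
          have := hmem.2
          rw [hb, norm_zero] at this
          linarith
      · have haR : 0 < a * R := by positivity
        have hθp : 0 < θ (f ξ) := by linarith
        have hmx : 0 < max 0 (R - Metric.infDist (f ξ) S1) :=
          pos_of_mul_pos_right hθp ha0.le
        have hlt : Metric.infDist (f ξ) S1 < R := by
          rcases lt_max_iff.mp hmx with h | h
          · exact absurd h (lt_irrefl _)
          · linarith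
        obtain ⟨s, hs, hds⟩ := (Metric.infDist_lt_iff hS1n).mp hlt
        have hsn : ‖s‖ = r := hs.2
        rw [dist_eq_norm] at hds
        have n1 := norm_sub_norm_le (f ξ) s
        have n2 := norm_sub_norm_le s (f ξ)
        rw [norm_sub_rev] at n2
        refine hreg1 _ ⟨⟨by linarith, by linarith⟩, ?_⟩
        rw [abs_le]
        constructor <;> linarith)
    f1 hf1 (fun ξ => (hf1ε ξ).le)
  obtain ⟨ξ, h1, h2⟩ := hlink f hfΓ
  have hz : Metric.infDist (f ξ) S1 = 0 := Metric.infDist_zero_of_mem ⟨h1, h2⟩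
  have h3 := hf ξ
  have h4 := hX₁ _ h1 (by linarith)
  have h5 : θ (f ξ) = a * R := by
    simp only [θ]
    rw [hz, sub_zero, max_eq_right hR0.le]
  linarith
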